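/- arXiv:2204.09235 — 6 statements merged into one kernel-verified Lean document; each statement's English description precedes it below -/
import Mathlib

section
/- Let R be a finite set of samples of even size m ≥ 2 with aggregation values a : R → ℝ, and let N_R ≥ 0 be a real number. Define for q ⊆ R the SUM-query sample-estimate variance ν_S(q) = (N_R²/m³)·(m·Σ_{t∈q} a(t)² − (Σ_{t∈q} a(t))²). If R is split into two disjoint sets R₁, R₂ with R₁ ∪ R₂ = R and |R₁| = |R₂| = m/2, then for every subset q ⊆ R we have max(ν_S(R₁), ν_S(R₂)) ≥ (1/4)·ν_S(q). In particular, the half with the larger sum of squared values achieves variance at least one quarter of the maximum SUM-query variance within R. -/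
/-- Splitting a partition `R` of even size `m ≥ 2` into two equal halves
`R₁, R₂`, the larger of the two SUM-query variances is at least a quarter of the
variance of any query `q ⊆ R`. -/
theorem stmt_1 {α : Type*} [DecidableEq α] (R R₁ R₂ : Finset α) (a : α → ℝ)
    (m : ℕ) (hm2 : 2 ≤ m) (hmeven : Even m) (hR : R.card = m)
    (N_R : ℝ) (hNR : 0 ≤ N_R)
    (hdisj : Disjoint R₁ R₂) (hunion : R₁ ∪ R₂ = R)
    (hcard1 : R₁.card = m / 2) (hcard2 : R₂.card = m / 2)
    (νS : Finset α → ℝ)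
    (hν : ∀ q : Finset α, νS q = N_R ^ 2 / (m : ℝ) ^ 3 *
      ((m : ℝ) * (∑ t ∈ q, (a t) ^ 2) - (∑ t ∈ q, a t) ^ 2)) :
    ∀ q ⊆ R, max (νS R₁) (νS R₂) ≥ (1 / 4) * νS q := by
  intro q hq
  have hc : (((m / 2 : ℕ) : ℝ)) = (m : ℝ) / 2 := by
    obtain ⟨k, rfl⟩ := hmeven
    have : (k + k) / 2 = k := by omega
    rw [this]; push_cast; ring
  have h1 := sq_sum_le_card_mul_sum_sq (s := R₁) (f := a)
  have h2 := sq_sum_le_card_mul_sum_sq (s := R₂) (f := a)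
  rw [hcard1, hc] at h1
  rw [hcard2, hc] at h2
  have h3 : ∑ t ∈ q, (a t) ^ 2 ≤ ∑ t ∈ R₁, (a t) ^ 2 + ∑ t ∈ R₂, (a t) ^ 2 := by
    rw [← Finset.sum_union hdisj, hunion]
    exact Finset.sum_le_sum_of_subset_of_nonneg hq (fun _ _ _ => sq_nonneg _)
  have h4 := mul_le_mul_of_nonneg_left h3 (Nat.cast_nonneg (α := ℝ) m)
  have hC : 0 ≤ N_R ^ 2 / (m : ℝ) ^ 3 := by positivity
  have key : (1 / 4) * νS q ≤ (νS R₁ + νS R₂) / 2 := by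
    rw [hν q, hν R₁, hν R₂]
    have h5 := sq_nonneg (∑ t ∈ q, a t)
    have h6 : (1 / 4) * ((m : ℝ) * (∑ t ∈ q, (a t) ^ 2) - (∑ t ∈ q, a t) ^ 2) ≤
      (((m : ℝ) * (∑ t ∈ R₁, (a t) ^ 2) - (∑ t ∈ R₁, a t) ^ 2) +
        ((m : ℝ) * (∑ t ∈ R₂, (a t) ^ 2) - (∑ t ∈ R₂, a t) ^ 2)) / 2 := by
      linarith
    have h7 := mul_le_mul_of_nonneg_left h6 hC
    linarith
  have h8 := le_max_left (νS R₁) (νS R₂)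
  have h9 := le_max_right (νS R₁) (νS R₂)
  linarith
end

section
/- Let R be a finite set of samples of size m with aggregation values a : R → ℝ, and let δm be a natural number with 1 ≤ δm and 2·δm ≤ m. Define for a nonempty q ⊆ R the AVG-query sample-estimate variance ν_A(q) = (1/(m·|q|²))·(m·Σ_{t∈q} a(t)² − (Σ_{t∈q} a(t))²). Let q* ⊆ R be a subset with |q*| = δm that maximizes Σ_{t∈q*} a(t)² among all subsets of R of cardinality δm. Then for every subset q ⊆ R with δm ≤ |q| ≤ 2·δm, we have ν_A(q*) ≥ (1/4)·ν_A(q). -/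
/-- A size-`δm` subset `q*` of `R` maximizing the sum of squared
aggregation values is a 1/4-approximation of the maximum-variance AVG query among
all queries `q ⊆ R` with `δm ≤ |q| ≤ 2·δm`. -/
theorem stmt_2 {α : Type*} (R : Finset α) (a : α → ℝ) (m δm : ℕ)
    (hR : R.card = m) (hδ1 : 1 ≤ δm) (hδ2 : 2 * δm ≤ m)
    (νA : Finset α → ℝ)
    (hν : ∀ q : Finset α, q.Nonempty →
      νA q = 1 / ((m : ℝ) * (q.card : ℝ) ^ 2) *
        ((m : ℝ) * (∑ t ∈ q, (a t) ^ 2) - (∑ t ∈ q, a t) ^ 2))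
    (qstar : Finset α) (hqstar : qstar ⊆ R) (hqcard : qstar.card = δm)
    (hmax : ∀ s ⊆ R, s.card = δm →
      (∑ t ∈ s, (a t) ^ 2) ≤ ∑ t ∈ qstar, (a t) ^ 2) :
    ∀ q ⊆ R, δm ≤ q.card → q.card ≤ 2 * δm → νA qstar ≥ (1 / 4) * νA q := by
  classical
  intro q hq h1 h2
  have hqs : qstar.Nonempty := Finset.card_pos.mp (by omega)
  have hqn : q.Nonempty := Finset.card_pos.mp (by omega)
  rw [hν q hqn, hν qstar hqs, hqcard]
  obtain ⟨s, hsq, hs⟩ := Finset.exists_subset_card_eq h1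
  have hc : (q \ s).card ≤ δm := by
    rw [Finset.card_sdiff_of_subset hsq]; omega
  obtain ⟨u, hu1, hu2, hu⟩ := Finset.exists_subsuperset_card_eq
    (Finset.sdiff_subset.trans hq : q \ s ⊆ R) hc (by omega)
  have e1 := hmax s (hsq.trans hq) hs
  have e2 := hmax u hu2 hu
  have e3 : ∑ t ∈ q \ s, (a t) ^ 2 ≤ ∑ t ∈ u, (a t) ^ 2 :=
    Finset.sum_le_sum_of_subset_of_nonneg hu1 (fun _ _ _ => sq_nonneg _)
  have e4 := Finset.sum_sdiff (f := fun t => (a t) ^ 2) hsq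
  have cs : (∑ t ∈ qstar, a t) ^ 2 ≤ (qstar.card : ℝ) * ∑ t ∈ qstar, (a t) ^ 2 :=
    sq_sum_le_card_mul_sum_sq
  rw [hqcard] at cs
  have hS : 0 ≤ ∑ t ∈ qstar, (a t) ^ 2 := Finset.sum_nonneg (fun _ _ => sq_nonneg _)
  have hT : 0 ≤ (∑ t ∈ q, a t) ^ 2 := sq_nonneg _
  have hQ : ∑ t ∈ q, (a t) ^ 2 ≤ 2 * ∑ t ∈ qstar, (a t) ^ 2 := by linarith
  generalize ∑ t ∈ qstar, (a t) ^ 2 = S at *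
  generalize ∑ t ∈ q, (a t) ^ 2 = Q at *
  generalize (∑ t ∈ q, a t) ^ 2 = T at *
  generalize (∑ t ∈ qstar, a t) ^ 2 = U at *
  have hk : (1 : ℝ) ≤ δm := by exact_mod_cast hδ1
  have hm : 2 * (δm : ℝ) ≤ m := by exact_mod_cast hδ2
  have hn : (δm : ℝ) ≤ q.card := by exact_mod_cast h1
  generalize (q.card : ℝ) = n at *
  generalize (δm : ℝ) = k at *
  generalize (m : ℝ) = M at *
  have hM : 0 < M := by linarith
  have hk0 : 0 < k := by linarith
  have f1 : M * S / 2 ≤ M * S - U := by nlinarith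
  have f2 : M * Q - T ≤ 2 * (M * S) := by nlinarith
  have f3 : 1 / (M * n ^ 2) ≤ 1 / (M * k ^ 2) := by gcongr
  have g1 : 1 / (M * k ^ 2) * (M * S / 2) ≤ 1 / (M * k ^ 2) * (M * S - U) := by gcongr
  have g2 : 1 / (M * n ^ 2) * (M * Q - T) ≤ 1 / (M * n ^ 2) * (2 * (M * S)) := by
    gcongr
  have g3 : 1 / (M * n ^ 2) * (2 * (M * S)) ≤ 1 / (M * k ^ 2) * (2 * (M * S)) := by gcongr
  linarith
end

section
/- Let R be a finite set of samples of size m with aggregation values a : R → ℝ, let K ≥ 1 be a real number, and let q, q' ⊆ R satisfy: 1 ≤ |q'| ≤ |q|, 2·|q'| ≤ m, and Σ_{t∈q'} a(t)² ≥ (1/(2K))·Σ_{t∈q} a(t)². Define for a nonempty x ⊆ R the AVG-query sample-estimate variance ν_A(x) = (1/(m·|x|²))·(m·Σ_{t∈x} a(t)² − (Σ_{t∈x} a(t))²). Then ν_A(q') ≥ (1/(4K))·ν_A(q). -/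
/-- Algebraic core of the AVG-query index approximation guarantee:
if `q' ⊆ R` is nonempty, no larger than `q`, at most half of the `m` samples, and
captures at least a `1/(2K)` fraction of the sum of squares of `q`, then
`ν_A(q') ≥ (1/(4K))·ν_A(q)`. -/
theorem stmt_3 {α : Type*} (R : Finset α) (a : α → ℝ) (m : ℕ) (hR : R.card = m)
    (K : ℝ) (hK : 1 ≤ K) (q q' : Finset α) (hq : q ⊆ R) (hq' : q' ⊆ R)
    (h1 : 1 ≤ q'.card) (h2 : q'.card ≤ q.card) (h3 : 2 * q'.card ≤ m)
    (hsum : (∑ t ∈ q', (a t) ^ 2) ≥ 1 / (2 * K) * ∑ t ∈ q, (a t) ^ 2)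
    (νA : Finset α → ℝ)
    (hν : ∀ x : Finset α, x.Nonempty →
      νA x = 1 / ((m : ℝ) * (x.card : ℝ) ^ 2) *
        ((m : ℝ) * (∑ t ∈ x, (a t) ^ 2) - (∑ t ∈ x, a t) ^ 2)) :
    νA q' ≥ 1 / (4 * K) * νA q := by
  have hq'n : q'.Nonempty := Finset.card_pos.mp (by omega)
  have hqn : q.Nonempty := Finset.card_pos.mp (by omega)
  rw [hν q' hq'n, hν q hqn]
  have hcs : (∑ t ∈ q', a t) ^ 2 ≤ (q'.card : ℝ) * ∑ t ∈ q', (a t) ^ 2 :=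
    sq_sum_le_card_mul_sum_sq
  have hS' : 0 ≤ ∑ t ∈ q', (a t) ^ 2 := Finset.sum_nonneg fun t _ => sq_nonneg _
  have hS : 0 ≤ ∑ t ∈ q, (a t) ^ 2 := Finset.sum_nonneg fun t _ => sq_nonneg _
  have hT : 0 ≤ (∑ t ∈ q, a t) ^ 2 := sq_nonneg _
  have c1 : (1 : ℝ) ≤ q'.card := by exact_mod_cast h1
  have c2 : (q'.card : ℝ) ≤ q.card := by exact_mod_cast h2
  have c3 : 2 * (q'.card : ℝ) ≤ m := by exact_mod_cast h3
  generalize (∑ t ∈ q', (a t) ^ 2) = S' at *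
  generalize (∑ t ∈ q, (a t) ^ 2) = S at *
  generalize (∑ t ∈ q, a t) ^ 2 = T at *
  generalize (∑ t ∈ q', a t) ^ 2 = T' at *
  generalize (q'.card : ℝ) = c' at *
  generalize (q.card : ℝ) = c at *
  generalize (m : ℝ) = M at *
  have hc' : 0 < c' := by linarith
  have hM : 0 < M := by linarith
  have hK0 : 0 < K := by linarith
  have e1 : M * S' - T' ≥ M / 2 * S' := by nlinarith
  have e2 : M / 2 * S' ≥ M / 2 * (1 / (2 * K) * S) :=
    mul_le_mul_of_nonneg_left hsum (by positivity)
  calc 1 / (4 * K) * (1 / (M * c ^ 2) * (M * S - T))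
      ≤ 1 / (4 * K) * (1 / (M * c ^ 2) * (M * S)) := by
        have : 0 < c := by linarith
        gcongr
        linarith
    _ ≤ 1 / (4 * K) * (1 / (M * c' ^ 2) * (M * S)) := by gcongr
    _ = 1 / (M * c' ^ 2) * (M / 2 * (1 / (2 * K) * S)) := by
        field_simp
        ring
    _ ≤ 1 / (M * c' ^ 2) * (M * S' - T') := by
        apply mul_le_mul_of_nonneg_left _ (by positivity)
        linarith
end

section
/- Let R be a finite set of samples of size m ≥ 1 with aggregation values a : R → ℝ, and let N_R, N, U be real numbers with 0 ≤ N_R ≤ N and |a(t)| ≤ U for all t ∈ R. Define for q ⊆ R the SUM-query sample-estimate variance ν_S(q) = (N_R²/m³)·(m·Σ_{t∈q} a(t)² − (Σ_{t∈q} a(t))²). Then for every q ⊆ R, ν_S(q) ≤ N²·U², i.e., √(ν_S(q)) ≤ N·U. -/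
/-- Upper bound on the SUM-query sample-estimate variance:
`ν_S(q) ≤ N²·U²`, i.e. `√(ν_S(q)) ≤ N·U`. -/
theorem stmt_5 {α : Type*} (R : Finset α) (a : α → ℝ) (m : ℕ) (hm : 1 ≤ m)
    (hR : R.card = m) (N_R N U : ℝ) (hNR0 : 0 ≤ N_R) (hNRN : N_R ≤ N)
    (hU : ∀ t ∈ R, |a t| ≤ U)
    (νS : Finset α → ℝ)
    (hν : ∀ q : Finset α, νS q = N_R ^ 2 / (m : ℝ) ^ 3 *
      ((m : ℝ) * (∑ t ∈ q, (a t) ^ 2) - (∑ t ∈ q, a t) ^ 2)) :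
    ∀ q ⊆ R, νS q ≤ N ^ 2 * U ^ 2 ∧ Real.sqrt (νS q) ≤ N * U := by
  intro q hq
  have hm' : (1 : ℝ) ≤ m := by exact_mod_cast hm
  have hm0 : (0 : ℝ) < m := by linarith
  have hU0 : 0 ≤ U := by
    have hne : R.Nonempty := Finset.card_pos.mp (by omega)
    obtain ⟨t, ht⟩ := hne
    exact (abs_nonneg _).trans (hU t ht)
  have h1 : ∑ t ∈ q, (a t) ^ 2 ≤ m * U ^ 2 := by
    calc ∑ t ∈ q, (a t) ^ 2 ≤ ∑ t ∈ R, (a t) ^ 2 :=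
          Finset.sum_le_sum_of_subset_of_nonneg hq (fun t _ _ => sq_nonneg _)
      _ ≤ ∑ t ∈ R, U ^ 2 := Finset.sum_le_sum (fun t ht => by
          rw [← sq_abs]
          exact pow_le_pow_left₀ (abs_nonneg _) (hU t ht) 2)
      _ = m * U ^ 2 := by simp [hR]
  have h2 : (m : ℝ) * (∑ t ∈ q, (a t) ^ 2) - (∑ t ∈ q, a t) ^ 2 ≤ m ^ 2 * U ^ 2 := by
    have := mul_le_mul_of_nonneg_left h1 hm0.le
    nlinarith [sq_nonneg (∑ t ∈ q, a t)]
  have h3 : νS q ≤ N ^ 2 * U ^ 2 := by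
    rw [hν]
    calc _ ≤ N_R ^ 2 / (m : ℝ) ^ 3 * (m ^ 2 * U ^ 2) :=
          mul_le_mul_of_nonneg_left h2 (by positivity)
      _ = (N_R ^ 2 * U ^ 2) / m := by field_simp
      _ ≤ N_R ^ 2 * U ^ 2 := div_le_self (by positivity) hm'
      _ ≤ N ^ 2 * U ^ 2 := by gcongr
  refine ⟨h3, Real.sqrt_le_iff.mpr ⟨mul_nonneg (hNR0.trans hNRN) hU0, ?_⟩⟩
  rw [mul_pow]
  exact h3
end

section
/- Let R be a finite set of samples of size m ≥ 1 with aggregation values a : R → ℝ, let L > 0 and N_R ≥ m be real numbers, and suppose every t ∈ R satisfies a(t) = 0 or a(t) ≥ L. Let q' ⊆ R be a subset with 2·|q'| ≤ m that contains at least one tuple t₀ with a(t₀) ≠ 0. Define the SUM-query sample-estimate variance ν_S(q') = (N_R²/m³)·(m·Σ_{t∈q'} a(t)² − (Σ_{t∈q'} a(t))²). Then ν_S(q') ≥ L²/2, i.e., √(ν_S(q')) ≥ L/√2. -/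
/-- Lower bound on the SUM-query sample-estimate variance: if every
aggregation value is `0` or at least `L > 0`, `N_R ≥ m`, and `q'` contains at most
half of the samples and some tuple with nonzero value, then `ν_S(q') ≥ L²/2`,
i.e. `√(ν_S(q')) ≥ L/√2`. -/
theorem stmt_6 {α : Type*} (R : Finset α) (a : α → ℝ) (m : ℕ) (hm : 1 ≤ m)
    (hR : R.card = m) (L N_R : ℝ) (hL : 0 < L) (hNR : (m : ℝ) ≤ N_R)
    (hval : ∀ t ∈ R, a t = 0 ∨ L ≤ a t)
    (q' : Finset α) (hq' : q' ⊆ R) (hcard : 2 * q'.card ≤ m)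
    (t₀ : α) (ht₀ : t₀ ∈ q') (ht₀a : a t₀ ≠ 0)
    (νS : Finset α → ℝ)
    (hν : ∀ q : Finset α, νS q = N_R ^ 2 / (m : ℝ) ^ 3 *
      ((m : ℝ) * (∑ t ∈ q, (a t) ^ 2) - (∑ t ∈ q, a t) ^ 2)) :
    νS q' ≥ L ^ 2 / 2 ∧ Real.sqrt (νS q') ≥ L / Real.sqrt 2 := by
  have key : νS q' ≥ L ^ 2 / 2 := by
    have hmpos : (0 : ℝ) < m := by exact_mod_cast hm
    have hc : 2 * (q'.card : ℝ) ≤ m := by exact_mod_cast hcard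
    have hLa : L ≤ a t₀ := (hval t₀ (hq' ht₀)).resolve_left ht₀a
    have h1 : a t₀ ^ 2 ≤ ∑ t ∈ q', a t ^ 2 :=
      Finset.single_le_sum (f := fun t => a t ^ 2) (fun t _ => sq_nonneg (a t)) ht₀
    have h2 : L ^ 2 ≤ ∑ t ∈ q', a t ^ 2 := by nlinarith
    have h3 : (∑ t ∈ q', a t) ^ 2 ≤ q'.card * ∑ t ∈ q', a t ^ 2 :=
      sq_sum_le_card_mul_sum_sq
    have h4 : (m : ℝ) / 2 * L ^ 2 ≤
        (m : ℝ) * (∑ t ∈ q', (a t) ^ 2) - (∑ t ∈ q', a t) ^ 2 := by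
      have hS : 0 ≤ ∑ t ∈ q', a t ^ 2 := (sq_nonneg L).trans h2
      have h5 := mul_le_mul_of_nonneg_right hc hS
      have h6 := mul_le_mul_of_nonneg_left h2 hmpos.le
      linarith
    have h7 : 1 / (m : ℝ) ≤ N_R ^ 2 / (m : ℝ) ^ 3 := by
      rw [div_le_div_iff₀ hmpos (by positivity)]
      have h8 : (m : ℝ) ^ 2 ≤ N_R ^ 2 := by gcongr
      nlinarith
    rw [hν]
    calc L ^ 2 / 2 = 1 / (m : ℝ) * ((m : ℝ) / 2 * L ^ 2) := by field_simp
      _ ≤ _ := mul_le_mul h7 h4 (by positivity) (by positivity)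
  refine ⟨key, ?_⟩
  have h9 := Real.sqrt_le_sqrt key
  rwa [Real.sqrt_div (sq_nonneg L), Real.sqrt_sq hL.le] at h9
end

section
/- Let R be a finite set of samples of size m with aggregation values a : R → ℝ, let L > 0 and N ≥ 1 be real numbers, and suppose every t ∈ R satisfies a(t) = 0 or a(t) ≥ L. Let q' ⊆ R be a subset with 1 ≤ |q'| ≤ N and 2·|q'| ≤ m that contains at least one tuple t₀ with a(t₀) ≠ 0. Define the AVG-query sample-estimate variance ν_A(q') = (1/(m·|q'|²))·(m·Σ_{t∈q'} a(t)² − (Σ_{t∈q'} a(t))²). Then ν_A(q') ≥ L²/(2·N²), i.e., √(ν_A(q')) ≥ L/(√2·N). -/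
/-- Lower bound on the AVG-query sample-estimate variance: if every
aggregation value is `0` or at least `L > 0`, and `q'` has `1 ≤ |q'| ≤ N`,
`2·|q'| ≤ m`, and contains a tuple with nonzero value, then
`ν_A(q') ≥ L²/(2·N²)`, i.e. `√(ν_A(q')) ≥ L/(√2·N)`. -/
theorem stmt_8 {α : Type*} (R : Finset α) (a : α → ℝ) (m : ℕ)
    (hR : R.card = m) (L N : ℝ) (hL : 0 < L) (hN : 1 ≤ N)
    (hval : ∀ t ∈ R, a t = 0 ∨ L ≤ a t)
    (q' : Finset α) (hq' : q' ⊆ R) (h1 : 1 ≤ q'.card)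
    (h2 : (q'.card : ℝ) ≤ N) (h3 : 2 * q'.card ≤ m)
    (t₀ : α) (ht₀ : t₀ ∈ q') (ht₀a : a t₀ ≠ 0)
    (νA : Finset α → ℝ)
    (hν : ∀ q : Finset α, q.Nonempty →
      νA q = 1 / ((m : ℝ) * (q.card : ℝ) ^ 2) *
        ((m : ℝ) * (∑ t ∈ q, (a t) ^ 2) - (∑ t ∈ q, a t) ^ 2)) :
    νA q' ≥ L ^ 2 / (2 * N ^ 2) ∧
      Real.sqrt (νA q') ≥ L / (Real.sqrt 2 * N) := by
  have hcs := sq_sum_le_card_mul_sum_sq (s := q') (f := a)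
  have hS : L ^ 2 ≤ ∑ t ∈ q', (a t) ^ 2 := by
    have h := Finset.single_le_sum (f := fun t => (a t) ^ 2)
      (fun i _ => sq_nonneg (a i)) ht₀
    have hLa : L ≤ a t₀ := (hval t₀ (hq' ht₀)).resolve_left ht₀a
    have h' : L ^ 2 ≤ a t₀ ^ 2 := by gcongr
    exact h'.trans h
  have hk : (1 : ℝ) ≤ q'.card := by exact_mod_cast h1
  have hm : 2 * (q'.card : ℝ) ≤ m := by exact_mod_cast h3
  have hmain : νA q' ≥ L ^ 2 / (2 * N ^ 2) := by
    rw [hν q' ⟨t₀, ht₀⟩]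
    generalize (∑ t ∈ q', (a t) ^ 2) = S at *
    generalize (∑ t ∈ q', a t) = T at *
    generalize (q'.card : ℝ) = k at *
    generalize (m : ℝ) = M at *
    have hM : 0 < M := by linarith
    have hk0 : 0 < k := by linarith
    have hS0 : 0 ≤ S := (sq_nonneg L).trans hS
    have hnum : M * L ^ 2 / 2 ≤ M * S - T ^ 2 := by
      nlinarith [mul_le_mul_of_nonneg_right hm hS0, mul_le_mul_of_nonneg_left hS hM.le]
    calc L ^ 2 / (2 * N ^ 2) ≤ L ^ 2 / (2 * k ^ 2) := by gcongr
      _ = 1 / (M * k ^ 2) * (M * L ^ 2 / 2) := by field_simp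
      _ ≤ _ := by gcongr
  refine ⟨hmain, ?_⟩
  apply Real.le_sqrt_of_sq_le
  rw [div_pow, mul_pow, Real.sq_sqrt (by norm_num)]
  exact hmain
end
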